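/- For every θ ≥ 2 and every choice of constants in the Harnack assumptions there exists C_2 > 0 and, for every c_0 > 0, a constant C_1 > 0 (depending additionally on c_0), such that: for every Markov kernel (Γ,K,π) that is lazy and satisfies the Harnack assumptions with parameter θ and those constants, for every integer n ≥ c_0·D^θ and all x,y ∈ V, |k^n(x,y) − 1| ≤ C_1·exp(−C_2·n/D^θ). -/

import Mathlib

open Finset
open scoped Classical

variable {V : Type*} [Fintype V] [DecidableEq V]

/-- `matpow K n` is the `n`-th matrix power of the kernel `K`. -/
noncomputable def matpow (K : V → V → ℝ) : ℕ → V → V → ℝ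
  | 0 => fun x y => if x = y then (1 : ℝ) else 0
  | n + 1 => fun x y => ∑ z, K x z * matpow K n z y

/-- `(Γ, K, π)` is a Markov kernel: `G` is a connected (simple) graph on the finite vertex
set `V`, `K` is a stochastic kernel, irreducible, reversible with respect to the probability
measure `pi`, positive on edges and vanishing off edges (apart from the diagonal). -/
def IsMarkovKernel (G : SimpleGraph V) (K : V → V → ℝ) (pi : V → ℝ) : Prop :=
  G.Connected ∧
  (∀ x y, 0 ≤ K x y) ∧ (∀ x, ∑ y, K x y = 1) ∧
  (∀ x, 0 < pi x) ∧ (∑ x, pi x = 1) ∧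
  (∀ x y, pi x * K x y = pi y * K y x) ∧
  (∀ x y, G.Adj x y → 0 < K x y) ∧
  (∀ x y, x ≠ y → ¬ G.Adj x y → K x y = 0) ∧
  (∀ x y, ∃ n, 0 < matpow K n x y)

/-- Aperiodicity of an irreducible finite kernel, via primitivity. -/
def Aperiodic (K : V → V → ℝ) : Prop :=
  ∃ N : ℕ, ∀ n ≥ N, ∀ x y, 0 < matpow K n x y

/-- `K` is lazy if `K(x,x) ≥ 1/2` for all `x`. -/
def Lazy (K : V → V → ℝ) : Prop := ∀ x, (1 : ℝ) / 2 ≤ K x x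

/-- The closed ball `B(x,r)` for the graph distance. -/
noncomputable def gball (G : SimpleGraph V) (x : V) (r : ℝ) : Finset V :=
  univ.filter fun y => (G.dist x y : ℝ) ≤ r

/-- The volume `V(x,r) = π(B(x,r))`. -/
noncomputable def vol (G : SimpleGraph V) (pi : V → ℝ) (x : V) (r : ℝ) : ℝ :=
  ∑ y ∈ gball G x r, pi y

/-- The diameter of the graph `G`. -/
noncomputable def gdiam (G : SimpleGraph V) : ℕ :=
  univ.sup fun x => univ.sup fun y => G.dist x y

/-- The normalized kernel `k^n(x,y) = K^n(x,y)/π(y)`. -/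
noncomputable def knorm (K : V → V → ℝ) (pi : V → ℝ) (n : ℕ) (x y : V) : ℝ :=
  matpow K n x y / pi y

/-- The normalized Green function `𝒢(x,y) = ∑_{n≥0} (k^n(x,y) - 1)`. -/
noncomputable def green (K : V → V → ℝ) (pi : V → ℝ) (x y : V) : ℝ :=
  ∑' n : ℕ, (knorm K pi n x y - 1)

/-- `avoid K y n x = P_x(X_0 ≠ y, …, X_n ≠ y) = P_x(τ_y > n)`. -/
noncomputable def avoid (K : V → V → ℝ) (y : V) : ℕ → V → ℝ
  | 0 => fun x => if x = y then 0 else 1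
  | n + 1 => fun x => if x = y then 0 else ∑ z, K x z * avoid K y n z

/-- The expected hitting time `H(x,y) = E_x[τ_y] = ∑_{n≥0} P_x(τ_y > n)`. -/
noncomputable def hit (K : V → V → ℝ) (x y : V) : ℝ := ∑' n : ℕ, avoid K y n x

/-- `P_x(d(x, X_s) > R)` for the chain driven by `K` started at `x`. -/
noncomputable def probGt (G : SimpleGraph V) (K : V → V → ℝ) (x : V) (s : ℕ) (R : ℝ) : ℝ :=
  ∑ y ∈ univ.filter (fun y => R < (G.dist x y : ℝ)), matpow K s x y

/-- The probability that the chain driven by `K`, started at `x`, produces a trajectory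
`(X_0, …, X_t)` belonging to the event `A`. -/
noncomputable def pathProb (K : V → V → ℝ) (x : V) (t : ℕ)
    (A : (Fin (t + 1) → V) → Prop) : ℝ :=
  ∑ p ∈ univ.filter (fun p : Fin (t + 1) → V => p 0 = x ∧ A p),
    ∏ i : Fin t, K (p i.castSucc) (p i.succ)

/-- Condition (E): ellipticity with constant `p0`. -/
def CondE (G : SimpleGraph V) (K : V → V → ℝ) (p0 : ℝ) : Prop :=
  ∀ x y, G.Adj x y → p0 ≤ K x y

/-- Condition (VD): volume doubling with constant `CD`. -/
def CondVD (G : SimpleGraph V) (pi : V → ℝ) (CD : ℝ) : Prop :=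
  ∀ x : V, ∀ r : ℝ, 0 < r → vol G pi x (2 * r) ≤ CD * vol G pi x r

/-- The `π`-average of `f` over the ball `B(x,r)`. -/
noncomputable def ballAvg (G : SimpleGraph V) (pi : V → ℝ) (x : V) (r : ℝ) (f : V → ℝ) : ℝ :=
  (vol G pi x r)⁻¹ * ∑ z ∈ gball G x r, f z * pi z

/-- Condition (PI(θ)): Poincaré inequality with constant `CP`. -/
def CondPI (G : SimpleGraph V) (K : V → V → ℝ) (pi : V → ℝ) (θ CP : ℝ) : Prop :=
  ∀ x : V, ∀ r : ℝ, 0 < r → ∀ f : V → ℝ,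
    (∑ z ∈ gball G x r, |f z - ballAvg G pi x r f| ^ 2 * pi z) ≤
      CP * r ^ θ * ∑ ξ ∈ gball G x r, ∑ ζ ∈ gball G x r,
        if G.Adj ξ ζ then |f ξ - f ζ| ^ 2 * K ξ ζ * pi ξ else 0

/-- Condition (CS(θ)): existence of cut-off functions. -/
def CondCS (G : SimpleGraph V) (K : V → V → ℝ) (pi : V → ℝ) (θ C1 C2 ε : ℝ) : Prop :=
  ∀ x : V, ∀ r : ℝ, 0 < r → ∃ σ : V → ℝ,
    (∀ y ∈ gball G x (r / 2), 1 ≤ σ y) ∧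
    (∀ y, y ∉ gball G x r → σ y = 0) ∧
    (∀ z y, |σ z - σ y| ≤ C1 * ((G.dist z y : ℝ) / r) ^ ε) ∧
    (∀ s : ℝ, 0 < s → s ≤ r → ∀ f : V → ℝ,
      (∑ z ∈ gball G x s, |f z| ^ 2 *
          ∑ y, (if G.Adj z y then |σ z - σ y| ^ 2 * K z y * pi z else 0)) ≤
        C2 * (s / r) ^ (2 * ε) *
          ((∑ z ∈ gball G x (2 * s), ∑ y ∈ gball G x (2 * s),
              if G.Adj z y then |f z - f y| ^ 2 * K z y * pi z else 0) +
            s ^ (-θ) * ∑ z ∈ gball G x (2 * s), |f z| ^ 2 * pi z))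

/-- The Harnack assumptions (E), (VD), (PI(θ)), (CS(θ)) with the given constants. -/
def Harnack (G : SimpleGraph V) (K : V → V → ℝ) (pi : V → ℝ)
    (θ p0 CD CP Ccs1 Ccs2 ε : ℝ) : Prop :=
  0 < p0 ∧ 0 < CD ∧ 0 < CP ∧ 0 < Ccs1 ∧ 0 < Ccs2 ∧ 0 < ε ∧
  CondE G K p0 ∧ CondVD G pi CD ∧ CondPI G K pi θ CP ∧ CondCS G K pi θ Ccs1 Ccs2 ε

section Aux

set_option linter.unusedSectionVars false

/-- Scalar Nash iteration. -/
theorem nash_iter (φ : ℕ → ℝ) (q T A B L β : ℝ) (hq : 1 < q) (hA : 0 < A) (hB : 0 < B)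
    (hL : 0 < L) (hβ : 0 < β) (hT : T = q ^ β)
    (hpos : ∀ n, 0 < φ n) (hanti : ∀ n, φ (n + 1) ≤ φ n)
    (hstep : ∀ n j : ℕ, φ n ≤ A * (L / T ^ j) * (φ n - φ (n + 1)) + B * q ^ j)
    (h0 : ∃ j : ℕ, φ 0 ≤ q ^ j ∧ T ^ j ≤ T * L) (n : ℕ) :
    φ n ≤ 2 * B ∨
      min (β * ((2 * B * q) ^ (-β) / (2 * A))) (1 / T) * (n + 1) / L ≤ φ n ^ (-β) := by
  have hq0 : 0 < q := by linarith
  have hT0 : 0 < T := by rw [hT]; positivity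
  have hTj : ∀ j : ℕ, T ^ j = (q ^ j) ^ β := by
    intro j
    rw [hT, ← Real.rpow_natCast, ← Real.rpow_natCast, ← Real.rpow_mul hq0.le,
      ← Real.rpow_mul hq0.le, mul_comm]
  set c := (2 * B * q) ^ (-β) / (2 * A) with hc
  set κ := min (β * c) (1 / T) with hκ
  induction n with
  | zero =>
    right
    obtain ⟨j, h1, h2⟩ := h0
    have h3 : (q ^ j) ^ (-β) ≤ φ 0 ^ (-β) :=
      Real.rpow_le_rpow_of_nonpos (hpos 0) h1 (by linarith)
    have h4 : (q ^ j) ^ (-β) = (T ^ j)⁻¹ := by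
      rw [hTj, Real.rpow_neg (by positivity)]
    have h5 : (T * L)⁻¹ ≤ (T ^ j)⁻¹ := by
      apply inv_anti₀ (by positivity) h2
    have h6 : κ * ((0 : ℕ) + 1) / L ≤ (T * L)⁻¹ := by
      have : κ ≤ 1 / T := min_le_right _ _
      calc κ * ((0 : ℕ) + 1) / L ≤ (1 / T) * ((0 : ℕ) + 1) / L := by gcongr
        _ = (T * L)⁻¹ := by simp; ring
    linarith
  | succ n ih =>
    by_cases hb : φ (n + 1) ≤ 2 * B
    · left; exact hb
    right
    push Not at hb
    have hn : 2 * B < φ n := lt_of_lt_of_le hb (hanti n)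
    have ih' : κ * (n + 1) / L ≤ φ n ^ (-β) := by
      rcases ih with h | h
      · linarith
      · exact h
    obtain ⟨j, hj1, hj2⟩ := exists_nat_pow_near (x := φ n / (2 * B)) (y := q)
      (by rw [le_div_iff₀ (by positivity)]; linarith) hq
    have e1 : B * q ^ j ≤ φ n / 2 := by
      rw [le_div_iff₀ (by positivity)] at hj1; linarith
    have hs := hstep n j
    have hTp : 0 < T ^ j := by positivity
    have e2 : φ n * (T ^ j / (2 * A * L)) ≤ φ n - φ (n + 1) := by
      have : φ n ≤ 2 * A * L / T ^ j * (φ n - φ (n + 1)) := by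
        have : A * (L / T ^ j) * (φ n - φ (n + 1)) =
          (2 * A * L / T ^ j * (φ n - φ (n + 1))) / 2 := by ring
        linarith
      calc φ n * (T ^ j / (2 * A * L)) ≤
          (2 * A * L / T ^ j * (φ n - φ (n + 1))) * (T ^ j / (2 * A * L)) := by gcongr
        _ = φ n - φ (n + 1) := by field_simp
    have e3 : φ n ^ β * (2 * B * q) ^ (-β) ≤ T ^ j := by
      rw [hTj]
      have : φ n / (2 * B * q) ≤ q ^ j := by
        rw [div_lt_iff₀ (by positivity), pow_succ] at hj2
        rw [div_le_iff₀ (by positivity)]; nlinarith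
      calc φ n ^ β * (2 * B * q) ^ (-β) = (φ n / (2 * B * q)) ^ β := by
            rw [Real.div_rpow (hpos n).le (by positivity), Real.rpow_neg (by positivity)]
            rfl
        _ ≤ (q ^ j) ^ β := by
            apply Real.rpow_le_rpow _ this hβ.le
            have := hpos n
            positivity
    set t := φ n ^ β * c / L with ht
    have e4 : t ≤ T ^ j / (2 * A * L) := by
      calc t = (φ n ^ β * (2 * B * q) ^ (-β)) / (2 * A * L) := by
            rw [ht, hc]; field_simp
        _ ≤ _ := by gcongr
    have e5 : φ (n + 1) ≤ φ n * Real.exp (-t) := by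
      have h1 : 1 - t ≤ Real.exp (-t) := by linarith [Real.add_one_le_exp (-t)]
      have h2 : φ n * t ≤ φ n * (T ^ j / (2 * A * L)) :=
        mul_le_mul_of_nonneg_left e4 (hpos n).le
      have h3 := mul_le_mul_of_nonneg_left h1 (hpos n).le
      linarith
    have e6 : (φ n * Real.exp (-t)) ^ (-β) ≤ φ (n + 1) ^ (-β) :=
      Real.rpow_le_rpow_of_nonpos (hpos _) e5 (by linarith)
    have e7 : (φ n * Real.exp (-t)) ^ (-β) = φ n ^ (-β) * Real.exp (β * t) := by
      rw [Real.mul_rpow (hpos n).le (Real.exp_pos _).le, ← Real.exp_mul]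
      ring_nf
    have e8 : φ n ^ (-β) * (1 + β * t) ≤ φ n ^ (-β) * Real.exp (β * t) := by
      apply mul_le_mul_of_nonneg_left _ (Real.rpow_nonneg (hpos n).le _)
      linarith [Real.add_one_le_exp (β * t)]
    have e9 : φ n ^ (-β) * (β * t) = β * c / L := by
      have : φ n ^ (-β) * φ n ^ β = 1 := by
        rw [← Real.rpow_add (hpos n)]; simp
      calc φ n ^ (-β) * (β * t) = (φ n ^ (-β) * φ n ^ β) * (β * c / L) := by rw [ht]; ring
        _ = _ := by rw [this, one_mul]
    have e10 : κ / L ≤ β * c / L := by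
      have : κ ≤ β * c := min_le_left _ _
      gcongr
    have e11 : κ * ((n + 1 : ℕ) + 1) / L = κ * (n + 1) / L + κ / L := by push_cast; ring
    rw [e11]
    linarith

variable {W : Type} [Fintype W] [DecidableEq W]

/-- A bundle of the basic properties of the kernel. -/
structure RevK (K : W → W → ℝ) (pi : W → ℝ) : Prop where
  nn : ∀ x y, 0 ≤ K x y
  one : ∀ x, ∑ y, K x y = 1
  pos : ∀ x, 0 < pi x
  tot : ∑ x, pi x = 1
  rev : ∀ x y, pi x * K x y = pi y * K y x

/-- The Markov operator. -/
noncomputable def PK (K : W → W → ℝ) (f : W → ℝ) : W → ℝ := fun x => ∑ z, K x z * f z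

/-- The inner product. -/
noncomputable def ip (pi : W → ℝ) (f g : W → ℝ) : ℝ := ∑ x, f x * g x * pi x

/-- Energy. -/
noncomputable def En (K : W → W → ℝ) (pi : W → ℝ) (f : W → ℝ) : ℝ :=
  ∑ x, ∑ y, |f x - f y| ^ 2 * K x y * pi x

theorem ip_comm (pi f g : W → ℝ) : ip pi f g = ip pi g f := by
  unfold ip; apply sum_congr rfl; intros; ring

theorem ip_self_nonneg {K : W → W → ℝ} {pi : W → ℝ} (h : RevK K pi) (f : W → ℝ) :
    0 ≤ ip pi f f := by
  unfold ip
  exact sum_nonneg fun x _ => mul_nonneg (mul_self_nonneg _) (h.pos x).le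

theorem ip_PK {K : W → W → ℝ} {pi : W → ℝ} (h : RevK K pi) (f g : W → ℝ) :
    ip pi (PK K f) g = ip pi f (PK K g) := by
  unfold ip PK
  simp only [sum_mul, mul_sum]
  rw [sum_comm]
  apply sum_congr rfl; intro x _
  apply sum_congr rfl; intro y _
  have := h.rev x y
  linear_combination (- f x * g y) * this

theorem PK_one {K : W → W → ℝ} {pi : W → ℝ} (h : RevK K pi) :
    PK K (fun _ => 1) = fun _ => 1 := by
  funext x; simp [PK, h.one]

theorem ip_PK_one {K : W → W → ℝ} {pi : W → ℝ} (h : RevK K pi) (f : W → ℝ) :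
    ip pi (PK K f) (fun _ => 1) = ip pi f (fun _ => 1) := by
  rw [ip_PK h, PK_one h]

theorem PK_contr {K : W → W → ℝ} {pi : W → ℝ} (h : RevK K pi) (f : W → ℝ) :
    ip pi (PK K f) (PK K f) ≤ ip pi f f := by
  have h1 : ip pi (PK K (fun x => f x ^ 2)) (fun _ => 1) = ip pi f f := by
    rw [ip_PK_one h]; unfold ip; apply sum_congr rfl; intros; ring
  rw [← h1]
  unfold ip
  apply sum_le_sum
  intro x _
  apply mul_le_mul_of_nonneg_right _ (h.pos x).le
  rw [mul_one]
  have := Finset.sum_mul_sq_le_sq_mul_sq univ (fun z => Real.sqrt (K x z))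
    (fun z => Real.sqrt (K x z) * f z)
  have e1 : ∀ z, Real.sqrt (K x z) ^ 2 = K x z := fun z => Real.sq_sqrt (h.nn x z)
  have e2 : ∀ z, Real.sqrt (K x z) * (Real.sqrt (K x z) * f z) = K x z * f z := by
    intro z; rw [← mul_assoc, ← sq, e1]
  simp only [mul_pow, e1, e2, h.one, one_mul] at this
  unfold PK
  nlinarith

theorem En_eq {K : W → W → ℝ} {pi : W → ℝ} (h : RevK K pi) (f : W → ℝ) :
    En K pi f = 2 * (ip pi f f - ip pi f (PK K f)) := by
  have a1 : ∑ x, ∑ y, f x ^ 2 * K x y * pi x = ip pi f f := by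
    unfold ip; apply sum_congr rfl; intro x _
    rw [← sum_mul, ← mul_sum, h.one]; ring
  have a2 : ∑ x, ∑ y, f y ^ 2 * K x y * pi x = ip pi f f := by
    rw [← a1, sum_comm]
    apply sum_congr rfl; intro x _
    apply sum_congr rfl; intro y _
    linear_combination (- f x ^ 2) * h.rev x y
  have a3 : ∑ x, ∑ y, f x * f y * K x y * pi x = ip pi f (PK K f) := by
    unfold ip PK; apply sum_congr rfl; intro x _
    rw [mul_sum, sum_mul]
    apply sum_congr rfl; intros; ring
  calc En K pi f = ∑ x, ∑ y, (f x ^ 2 * K x y * pi x + f y ^ 2 * K x y * pi x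
        - 2 * (f x * f y * K x y * pi x)) := by
        unfold En; apply sum_congr rfl; intro x _; apply sum_congr rfl; intro y _
        rw [sq_abs]; ring
    _ = _ := by
        simp only [sum_sub_distrib, sum_add_distrib, ← mul_sum]
        rw [a1, a2, a3]; ring

theorem lazy_pos {K : W → W → ℝ} {pi : W → ℝ} (h : RevK K pi) (hl : Lazy K) (f : W → ℝ) :
    ip pi (PK K f) (PK K f) ≤ ip pi f (PK K f) := by
  let Q : W → W → ℝ := fun x y => 2 * K x y - if x = y then 1 else 0
  have hQ : RevK Q pi := by
    refine ⟨?_, ?_, h.pos, h.tot, ?_⟩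
    · intro x y
      by_cases e : x = y
      · subst e; have := hl x; simp only [Q, if_true]; linarith
      · simp only [Q, if_neg e]; have := h.nn x y; linarith
    · intro x
      simp only [Q, sum_sub_distrib, ← mul_sum, h.one]
      simp; norm_num
    · intro x y
      by_cases e : x = y
      · subst e; rfl
      · have e' : ¬ y = x := fun h => e h.symm
        simp only [Q, if_neg e, if_neg e']
        linear_combination 2 * h.rev x y
  have hP : PK Q f = fun x => 2 * PK K f x - f x := by
    funext x
    simp only [PK, Q, sub_mul, sum_sub_distrib, mul_assoc, ← mul_sum]
    simp
  have := PK_contr hQ f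
  rw [hP] at this
  have e : ip pi (fun x => 2 * PK K f x - f x) (fun x => 2 * PK K f x - f x) =
      4 * ip pi (PK K f) (PK K f) - 4 * ip pi f (PK K f) + ip pi f f := by
    unfold ip
    simp only [mul_sum, ← sum_sub_distrib, ← sum_add_distrib]
    apply sum_congr rfl; intros; ring
  linarith

theorem drop {K : W → W → ℝ} {pi : W → ℝ} (h : RevK K pi) (hl : Lazy K) (f : W → ℝ) :
    En K pi f ≤ 2 * (ip pi f f - ip pi (PK K f) (PK K f)) := by
  rw [En_eq h]; have := lazy_pos h hl f; linarith

theorem En_nonneg {K : W → W → ℝ} {pi : W → ℝ} (h : RevK K pi) (f : W → ℝ) :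
    0 ≤ En K pi f :=
  sum_nonneg fun x _ => sum_nonneg fun y _ =>
    mul_nonneg (mul_nonneg (sq_nonneg _) (h.nn x y)) (h.pos x).le

/-- column heat kernel -/
theorem knorm_succ (K : W → W → ℝ) (pi : W → ℝ) (n : ℕ) (y : W) :
    (fun x => knorm K pi (n + 1) x y) = PK K (fun x => knorm K pi n x y) := by
  funext x
  simp only [knorm, matpow, PK, sum_div, mul_div_assoc]

theorem knorm_ip {K : W → W → ℝ} {pi : W → ℝ} (h : RevK K pi) (a b : ℕ) (x y : W) :
    ip pi (fun z => knorm K pi a z x) (fun z => knorm K pi b z y) = knorm K pi (a + b) x y := by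
  induction a generalizing b with
  | zero =>
    unfold ip
    rw [Finset.sum_eq_single x]
    · have := (h.pos x).ne'
      simp [knorm, matpow]
      field_simp
    · intro z _ hz
      simp [knorm, matpow, hz]
    · simp
  | succ a ih =>
    rw [knorm_succ, ip_PK h, ← knorm_succ, ih]
    congr 1; ring

theorem knorm_nonneg {K : W → W → ℝ} {pi : W → ℝ} (h : RevK K pi) (n : ℕ) (x y : W) :
    0 ≤ knorm K pi n x y := by
  induction n generalizing x with
  | zero =>
    have := h.pos y
    simp only [knorm, matpow]
    split_ifs <;> positivity
  | succ n ih =>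
    have := congrFun (knorm_succ K pi n y) x
    rw [this]
    exact sum_nonneg fun z _ => mul_nonneg (h.nn _ _) (ih z)

theorem knorm_mass {K : W → W → ℝ} {pi : W → ℝ} (h : RevK K pi) (n : ℕ) (y : W) :
    ip pi (fun z => knorm K pi n z y) (fun _ => 1) = 1 := by
  induction n with
  | zero =>
    unfold ip
    rw [Finset.sum_eq_single y]
    · have := (h.pos y).ne'
      simp [knorm, matpow]
      field_simp
    · intro z _ hz
      simp [knorm, matpow, hz]
    · simp
  | succ n ih => rw [knorm_succ, ip_PK_one h, ih]

theorem ip_sub_one {pi : W → ℝ} (f g : W → ℝ) (ht : ∑ x, pi x = 1)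
    (hf : ip pi f (fun _ => 1) = 1) (hg : ip pi g (fun _ => 1) = 1) :
    ip pi (fun z => f z - 1) (fun z => g z - 1) = ip pi f g - 1 := by
  have : ip pi (fun z => f z - 1) (fun z => g z - 1) =
      ip pi f g - ip pi f (fun _ => 1) - ip pi g (fun _ => 1) + ∑ x, pi x := by
    unfold ip
    simp only [← sum_sub_distrib, ← sum_add_distrib]
    apply sum_congr rfl; intros; ring
  rw [this, hf, hg, ht]; ring

theorem ip_cs {K : W → W → ℝ} {pi : W → ℝ} (h : RevK K pi) (f g : W → ℝ) :
    ip pi f g ^ 2 ≤ ip pi f f * ip pi g g := by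
  have := Finset.sum_mul_sq_le_sq_mul_sq univ (fun z => f z * Real.sqrt (pi z))
    (fun z => g z * Real.sqrt (pi z))
  have e1 : ∀ z, Real.sqrt (pi z) ^ 2 = pi z := fun z => Real.sq_sqrt (h.pos z).le
  have c1 : ip pi f g = ∑ z, f z * Real.sqrt (pi z) * (g z * Real.sqrt (pi z)) := by
    unfold ip; apply sum_congr rfl; intro z _; linear_combination (-f z * g z) * e1 z
  have c2 : ip pi f f = ∑ z, (f z * Real.sqrt (pi z)) ^ 2 := by
    unfold ip; apply sum_congr rfl; intro z _; linear_combination (-f z ^ 2) * e1 z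
  have c3 : ip pi g g = ∑ z, (g z * Real.sqrt (pi z)) ^ 2 := by
    unfold ip; apply sum_congr rfl; intro z _; linear_combination (-g z ^ 2) * e1 z
  rw [c1, c2, c3]; exact this

/-- ψ = variance of the heat kernel -/
noncomputable def psi (K : W → W → ℝ) (pi : W → ℝ) (y : W) (n : ℕ) : ℝ :=
  ip pi (fun z => knorm K pi n z y - 1) (fun z => knorm K pi n z y - 1)

/-- φ = squared norm of the heat kernel -/
noncomputable def phi (K : W → W → ℝ) (pi : W → ℝ) (y : W) (n : ℕ) : ℝ :=
  ip pi (fun z => knorm K pi n z y) (fun z => knorm K pi n z y)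

theorem psi_eq {K : W → W → ℝ} {pi : W → ℝ} (h : RevK K pi) (y : W) (n : ℕ) :
    psi K pi y n = phi K pi y n - 1 :=
  ip_sub_one _ _ h.tot (knorm_mass h n y) (knorm_mass h n y)

theorem psi_nonneg {K : W → W → ℝ} {pi : W → ℝ} (h : RevK K pi) (y : W) (n : ℕ) :
    0 ≤ psi K pi y n := ip_self_nonneg h _

theorem final_cs {K : W → W → ℝ} {pi : W → ℝ} (h : RevK K pi) (x y : W) (a b : ℕ) :
    (knorm K pi (a + b) x y - 1) ^ 2 ≤ psi K pi x a * psi K pi y b := by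
  rw [← knorm_ip h, ← ip_sub_one _ _ h.tot (knorm_mass h a x) (knorm_mass h b y)]
  exact ip_cs h _ _

theorem phi_drop {K : W → W → ℝ} {pi : W → ℝ} (h : RevK K pi) (hl : Lazy K) (y : W) (n : ℕ) :
    En K pi (fun z => knorm K pi n z y) ≤ 2 * (phi K pi y n - phi K pi y (n + 1)) := by
  have := drop h hl (fun z => knorm K pi n z y)
  rw [← knorm_succ] at this
  exact this

/-! Geometry. -/

theorem mem_gball (G : SimpleGraph W) (x y : W) (r : ℝ) :
    y ∈ gball G x r ↔ (G.dist x y : ℝ) ≤ r := by simp [gball]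

theorem dist_tri {G : SimpleGraph W} (hG : G.Connected) (x y z : W) :
    (G.dist x z : ℝ) ≤ G.dist x y + G.dist y z := by
  exact_mod_cast hG.dist_triangle

theorem vol_pos {K : W → W → ℝ} {pi : W → ℝ} (h : RevK K pi) (G : SimpleGraph W) (x : W) (r : ℝ)
    (hr : 0 ≤ r) : 0 < vol G pi x r :=
  sum_pos (fun z _ => h.pos z) ⟨x, by simp [mem_gball, hr]⟩

theorem exists_net {G : SimpleGraph W} (s : ℝ) (hs : 0 ≤ s) :
    ∃ S : Finset W, (∀ x ∈ S, ∀ y ∈ S, x ≠ y → s < (G.dist x y : ℝ)) ∧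
      ∀ z, ∃ x ∈ S, z ∈ gball G x s := by
  obtain ⟨S, hS, hmax⟩ := Finset.exists_max_image
    (univ.filter fun S : Finset W => ∀ x ∈ S, ∀ y ∈ S, x ≠ y → s < (G.dist x y : ℝ))
    (fun S => S.card) ⟨∅, by simp⟩
  simp only [mem_filter, mem_univ, true_and] at hS hmax
  refine ⟨S, hS, ?_⟩
  intro z
  by_contra hcon
  push Not at hcon
  simp only [mem_gball, not_le] at hcon
  have hz : z ∉ S := by
    intro hz
    have := hcon z hz
    simp at this; linarith
  have := hmax (insert z S) (by
    intro x hx y hy hxy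
    rw [mem_insert] at hx hy
    rcases hx with rfl | hx <;> rcases hy with rfl | hy
    · exact absurd rfl hxy
    · rw [SimpleGraph.dist_comm]; exact hcon y hy
    · exact hcon x hx
    · exact hS x hx y hy hxy)
  rw [card_insert_of_notMem hz] at this
  omega

theorem overlap {K : W → W → ℝ} {pi : W → ℝ} (h : RevK K pi) {G : SimpleGraph W}
    (hG : G.Connected) {q : ℝ} (hq : 0 < q) (hVD : CondVD G pi q) (s : ℝ) (hs : 0 < s)
    (S : Finset W) (hS : ∀ x ∈ S, ∀ y ∈ S, x ≠ y → s < (G.dist x y : ℝ)) (z : W) :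
    ((S.filter fun x => z ∈ gball G x s).card : ℝ) ≤ q ^ 3 := by
  set T := S.filter fun x => z ∈ gball G x s with hT
  have hv : 0 < vol G pi z (2 * s) := vol_pos h G z _ (by linarith)
  have h1 : ∑ x ∈ T, vol G pi x (s / 2) ≤ vol G pi z (2 * s) := by
    unfold vol
    rw [← sum_biUnion]
    · apply sum_le_sum_of_subset_of_nonneg
      · intro w hw
        simp only [mem_biUnion, hT, mem_filter, mem_gball] at hw
        obtain ⟨x, ⟨hx, hxz⟩, hxw⟩ := hw
        rw [mem_gball]
        have := dist_tri hG z x w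
        rw [SimpleGraph.dist_comm (u := z) (v := x)] at this
        linarith
      · intro w _ _; exact (h.pos w).le
    · intro x hx y hy hxy
      simp only [hT, coe_filter, Set.mem_ofPred_eq] at hx hy
      rw [Function.onFun, Finset.disjoint_left]
      intro w hw1 hw2
      rw [mem_gball] at hw1 hw2
      have h1 := hS x hx.1 y hy.1 hxy
      have h2 := dist_tri hG x w y
      rw [SimpleGraph.dist_comm (u := w) (v := y)] at h2
      linarith
  have h2 : ∀ x ∈ T, vol G pi z (2 * s) ≤ q ^ 3 * vol G pi x (s / 2) := by
    intro x hx
    simp only [hT, mem_filter, mem_gball] at hx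
    have a0 : vol G pi z (2 * s) ≤ vol G pi x (2 * (2 * s)) := by
      apply sum_le_sum_of_subset_of_nonneg
      · intro w hw
        rw [mem_gball] at hw ⊢
        have := dist_tri hG x z w
        linarith
      · intro w _ _; exact (h.pos w).le
    have a1 := hVD x (2 * s) (by linarith)
    have a2 := hVD x s hs
    have a3 := hVD x (s / 2) (by linarith)
    rw [show 2 * (s / 2) = s by ring] at a3
    calc vol G pi z (2 * s) ≤ q * vol G pi x (2 * s) := a0.trans a1
      _ ≤ q * (q * (q * vol G pi x (s / 2))) := by gcongr; exact a2.trans (by gcongr)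
      _ = _ := by ring
  have h3 : (T.card : ℝ) * vol G pi z (2 * s) ≤ q ^ 3 * vol G pi z (2 * s) := by
    calc (T.card : ℝ) * vol G pi z (2 * s) = ∑ x ∈ T, vol G pi z (2 * s) := by simp
      _ ≤ ∑ x ∈ T, q ^ 3 * vol G pi x (s / 2) := sum_le_sum h2
      _ = q ^ 3 * ∑ x ∈ T, vol G pi x (s / 2) := by rw [mul_sum]
      _ ≤ _ := by gcongr
  exact le_of_mul_le_mul_right h3 hv

theorem overlap_sum {G : SimpleGraph W} {N s : ℝ} (S : Finset W)
    (hN : ∀ z, ((S.filter fun x => z ∈ gball G x s).card : ℝ) ≤ N)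
    (g : W → ℝ) (hg : ∀ z, 0 ≤ g z) :
    ∑ x ∈ S, ∑ z ∈ gball G x s, g z ≤ N * ∑ z, g z := by
  have : ∑ x ∈ S, ∑ z ∈ gball G x s, g z =
      ∑ z, ∑ x ∈ S.filter (fun x => z ∈ gball G x s), g z := by
    apply sum_comm'
    intro x y; simp
  rw [this, mul_sum]
  apply sum_le_sum
  intro z _
  rw [sum_const, nsmul_eq_mul]
  exact mul_le_mul_of_nonneg_right (hN z) (hg z)

theorem ball_decomp {K : W → W → ℝ} {pi : W → ℝ} (h : RevK K pi) {G : SimpleGraph W}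
    (x : W) (r : ℝ) (hr : 0 ≤ r) (f : W → ℝ) :
    ∑ z ∈ gball G x r, f z ^ 2 * pi z =
      ∑ z ∈ gball G x r, |f z - ballAvg G pi x r f| ^ 2 * pi z +
        (∑ z ∈ gball G x r, f z * pi z) ^ 2 / vol G pi x r := by
  have hv := (vol_pos h G x r hr).ne'
  set m := ballAvg G pi x r f with hm
  set I := ∑ z ∈ gball G x r, f z * pi z with hI
  have e1 : m * vol G pi x r = I := by
    rw [hm, ballAvg]; field_simp; rfl
  have e2 : ∑ z ∈ gball G x r, |f z - m| ^ 2 * pi z =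
      ∑ z ∈ gball G x r, f z ^ 2 * pi z - 2 * m * I + m ^ 2 * vol G pi x r := by
    rw [hI]; unfold vol
    rw [mul_sum, mul_sum, ← sum_sub_distrib, ← sum_add_distrib]
    apply sum_congr rfl; intro z _; rw [sq_abs]; ring
  rw [e2, ← e1]; field_simp; ring

theorem ball_PI {K : W → W → ℝ} {pi : W → ℝ} (h : RevK K pi) {G : SimpleGraph W}
    {θ CP : ℝ} (hCP : 0 < CP) (hPI : CondPI G K pi θ CP) (x : W) (r : ℝ) (hr : 0 < r)
    (f : W → ℝ) :
    ∑ z ∈ gball G x r, |f z - ballAvg G pi x r f| ^ 2 * pi z ≤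
      CP * r ^ θ * ∑ z ∈ gball G x r, ∑ y, |f z - f y| ^ 2 * K z y * pi z := by
  refine (hPI x r hr f).trans ?_
  have : 0 ≤ CP * r ^ θ := by positivity
  apply mul_le_mul_of_nonneg_left _ this
  apply sum_le_sum; intro z _
  have nn : ∀ y, 0 ≤ |f z - f y| ^ 2 * K z y * pi z := fun y =>
    mul_nonneg (mul_nonneg (sq_nonneg _) (h.nn z y)) (h.pos z).le
  calc _ ≤ ∑ y ∈ gball G x r, |f z - f y| ^ 2 * K z y * pi z := by
        apply sum_le_sum; intro y _
        split_ifs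
        · exact le_rfl
        · exact nn y
    _ ≤ _ := sum_le_sum_of_subset_of_nonneg (subset_univ _) fun y _ _ => nn y

theorem nash {K : W → W → ℝ} {pi : W → ℝ} (h : RevK K pi) {G : SimpleGraph W}
    (hG : G.Connected) {q θ CP : ℝ} (hq : 0 < q) (hCP : 0 < CP) (hVD : CondVD G pi q)
    (hPI : CondPI G K pi θ CP) (s : ℝ) (hs : 0 < s) (Λ : ℝ) (hΛ : 0 < Λ)
    (hvol : ∀ x, 1 ≤ Λ * vol G pi x s)
    (f : W → ℝ) (hf : ∀ x, 0 ≤ f x) (hf1 : ip pi f (fun _ => 1) = 1) :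
    ip pi f f ≤ q ^ 3 * (CP * s ^ θ) * En K pi f + (q ^ 3) ^ 2 * Λ := by
  obtain ⟨S, hS, hcov⟩ := exists_net (G := G) s hs.le
  have hN := overlap h hG hq hVD s hs S hS
  have b1 : ip pi f f ≤ ∑ x ∈ S, ∑ z ∈ gball G x s, f z ^ 2 * pi z := by
    have : ∑ x ∈ S, ∑ z ∈ gball G x s, f z ^ 2 * pi z =
        ∑ z, ∑ x ∈ S.filter (fun x => z ∈ gball G x s), f z ^ 2 * pi z := by
      apply sum_comm'
      intro x y; simp
    rw [this]
    unfold ip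
    apply sum_le_sum; intro z _
    obtain ⟨x, hx, hxz⟩ := hcov z
    have nn : 0 ≤ f z ^ 2 * pi z := mul_nonneg (sq_nonneg _) (h.pos z).le
    have := single_le_sum (s := S.filter (fun x => z ∈ gball G x s))
      (f := fun _ => f z ^ 2 * pi z) (fun _ _ => nn) (a := x) (by simp [hx, hxz])
    rw [← sq]; exact this
  have b2 : ∀ x ∈ S, ∑ z ∈ gball G x s, f z ^ 2 * pi z ≤
      CP * s ^ θ * ∑ z ∈ gball G x s, ∑ y, |f z - f y| ^ 2 * K z y * pi z +
        Λ * (∑ z ∈ gball G x s, f z * pi z) ^ 2 := by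
    intro x _
    rw [ball_decomp h x s hs.le f]
    apply add_le_add (ball_PI h hCP hPI x s hs f)
    rw [div_le_iff₀ (vol_pos h G x s hs.le)]
    nlinarith [hvol x, sq_nonneg (∑ z ∈ gball G x s, f z * pi z)]
  have b3 : ∑ x ∈ S, ∑ z ∈ gball G x s, ∑ y, |f z - f y| ^ 2 * K z y * pi z ≤
      q ^ 3 * En K pi f := by
    apply overlap_sum S hN
    intro z
    exact sum_nonneg fun y _ =>
      mul_nonneg (mul_nonneg (sq_nonneg _) (h.nn z y)) (h.pos z).le
  have nn : ∀ z, 0 ≤ f z * pi z := fun z => mul_nonneg (hf z) (h.pos z).le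
  have b4 : ∑ x ∈ S, ∑ z ∈ gball G x s, f z * pi z ≤ q ^ 3 := by
    have := overlap_sum (g := fun z => f z * pi z) S hN nn
    have e : ∑ z, f z * pi z = 1 := by
      rw [← hf1]; unfold ip; simp
    rw [e, mul_one] at this
    exact this
  have b5 : ∑ x ∈ S, (∑ z ∈ gball G x s, f z * pi z) ^ 2 ≤ (q ^ 3) ^ 2 := by
    have nn' : ∀ x ∈ S, 0 ≤ ∑ z ∈ gball G x s, f z * pi z := fun x _ =>
      sum_nonneg fun z _ => nn z
    calc _ ≤ (∑ x ∈ S, ∑ z ∈ gball G x s, f z * pi z) ^ 2 := sum_sq_le_sq_sum_of_nonneg nn'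
      _ ≤ _ := pow_le_pow_left₀ (sum_nonneg nn') b4 2
  calc ip pi f f ≤ _ := b1
    _ ≤ _ := sum_le_sum b2
    _ = CP * s ^ θ * ∑ x ∈ S, ∑ z ∈ gball G x s, ∑ y, |f z - f y| ^ 2 * K z y * pi z +
        Λ * ∑ x ∈ S, (∑ z ∈ gball G x s, f z * pi z) ^ 2 := by
        rw [sum_add_distrib, mul_sum, mul_sum]
    _ ≤ CP * s ^ θ * (q ^ 3 * En K pi f) + Λ * (q ^ 3) ^ 2 := by gcongr
    _ = _ := by ring

theorem dist_le_gdiam (G : SimpleGraph W) (x y : W) : G.dist x y ≤ gdiam G := by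
  unfold gdiam
  exact (Finset.le_sup (f := fun y => G.dist x y) (mem_univ y)).trans
    (Finset.le_sup (f := fun x => univ.sup fun y => G.dist x y) (mem_univ x))

theorem gball_diam (G : SimpleGraph W) (x : W) : gball G x (gdiam G) = univ := by
  ext y; simp [mem_gball, dist_le_gdiam]

theorem vol_scale {K : W → W → ℝ} {pi : W → ℝ} (h : RevK K pi) {G : SimpleGraph W}
    {q : ℝ} (hq : 0 < q) (hVD : CondVD G pi q) (hD : 0 < gdiam G) (x : W) (j : ℕ) :
    1 ≤ q ^ j * vol G pi x ((gdiam G : ℝ) / 2 ^ j) := by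
  have hD' : (0 : ℝ) < gdiam G := by exact_mod_cast hD
  induction j with
  | zero => simp [vol, gball_diam, h.tot]
  | succ j ih =>
    have := hVD x ((gdiam G : ℝ) / 2 ^ (j + 1)) (by positivity)
    rw [show 2 * ((gdiam G : ℝ) / 2 ^ (j + 1)) = (gdiam G : ℝ) / 2 ^ j by
      rw [pow_succ]; field_simp] at this
    calc 1 ≤ _ := ih
      _ ≤ q ^ j * (q * vol G pi x ((gdiam G : ℝ) / 2 ^ (j + 1))) := by gcongr
      _ = _ := by ring

theorem gap {K : W → W → ℝ} {pi : W → ℝ} (h : RevK K pi) (hl : Lazy K) {G : SimpleGraph W}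
    {θ CP : ℝ} (hCP : 0 < CP) (hPI : CondPI G K pi θ CP) (hD : 0 < gdiam G) (y : W) (n k : ℕ) :
    psi K pi y (n + k) ≤ Real.exp (-(k * (1 / (2 * CP * (gdiam G : ℝ) ^ θ)))) * psi K pi y n := by
  have hD' : (0 : ℝ) < gdiam G := by exact_mod_cast hD
  have hL : (0 : ℝ) < (gdiam G : ℝ) ^ θ := by positivity
  set γ := 1 / (2 * CP * (gdiam G : ℝ) ^ θ) with hγ
  have step : ∀ m, psi K pi y (m + 1) ≤ Real.exp (-γ) * psi K pi y m := by
    intro m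
    set f : W → ℝ := fun z => knorm K pi m z y with hf
    have h1 := ball_PI h hCP hPI y (gdiam G) hD' f
    have h2 := ball_decomp h (G := G) y (gdiam G) hD'.le f
    rw [gball_diam] at h1 h2
    have hv : vol G pi y (gdiam G) = 1 := by simp [vol, gball_diam, h.tot]
    have hm : ∑ z, f z * pi z = 1 := by
      rw [← knorm_mass h m y]; unfold ip; simp [hf]
    have hp : ∑ z, f z ^ 2 * pi z = phi K pi y m := by
      unfold phi ip; apply sum_congr rfl; intros; simp only [hf]; ring
    rw [hv, hm, hp] at h2
    have h3 := phi_drop h hl y m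
    have e0 := psi_eq h y m
    have e1 := psi_eq h y (m + 1)
    have h4 : psi K pi y m ≤ CP * (gdiam G : ℝ) ^ θ * (2 * (psi K pi y m - psi K pi y (m + 1))) := by
      have : CP * (gdiam G : ℝ) ^ θ * En K pi f ≤
          CP * (gdiam G : ℝ) ^ θ * (2 * (psi K pi y m - psi K pi y (m + 1))) := by
        apply mul_le_mul_of_nonneg_left _ (by positivity)
        rw [e0, e1]; linarith
      refine le_trans ?_ this
      refine le_trans ?_ h1
      linarith
    have h5 : γ * psi K pi y m ≤ psi K pi y m - psi K pi y (m + 1) := by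
      rw [hγ, one_div, inv_mul_le_iff₀ (by positivity)]
      linarith
    have h6 : (1 - γ) * psi K pi y m ≤ Real.exp (-γ) * psi K pi y m := by
      apply mul_le_mul_of_nonneg_right _ (psi_nonneg h y m)
      linarith [Real.add_one_le_exp (-γ)]
    linarith
  induction k with
  | zero => simp
  | succ k ih =>
    calc psi K pi y (n + (k + 1)) ≤ Real.exp (-γ) * psi K pi y (n + k) := step (n + k)
      _ ≤ Real.exp (-γ) * (Real.exp (-(k * γ)) * psi K pi y n) := by gcongr
      _ = _ := by
        rw [← mul_assoc, ← Real.exp_add]; push_cast; congr 2; ring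

theorem phi_bound {K : W → W → ℝ} {pi : W → ℝ} (h : RevK K pi) (hl : Lazy K)
    {G : SimpleGraph W} (hG : G.Connected) {q θ CP : ℝ} (hq : 1 < q) (hθ : 0 < θ) (hCP : 0 < CP)
    (hVD : CondVD G pi q) (hPI : CondPI G K pi θ CP) (hD : 0 < gdiam G) (y : W) (n : ℕ) :
    phi K pi y n ≤ 2 * (q ^ 3) ^ 2 ∨
      min (Real.logb q (2 ^ θ) * ((2 * (q ^ 3) ^ 2 * q) ^ (-Real.logb q (2 ^ θ)) /
        (2 * (2 * (q ^ 3 * CP))))) (1 / 2 ^ θ) * (n + 1) / (gdiam G : ℝ) ^ θ ≤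
        phi K pi y n ^ (-Real.logb q (2 ^ θ)) := by
  have hD' : (0 : ℝ) < gdiam G := by exact_mod_cast hD
  have hq0 : 0 < q := by linarith
  have hT1 : (1 : ℝ) < 2 ^ θ := Real.one_lt_rpow (by norm_num) hθ
  have hpow : ∀ j : ℕ, ((2 : ℝ) ^ j) ^ θ = (2 ^ θ) ^ j := by
    intro j
    rw [← Real.rpow_natCast, ← Real.rpow_natCast, ← Real.rpow_mul (by norm_num),
      ← Real.rpow_mul (by norm_num), mul_comm]
  apply nash_iter (phi K pi y) q (2 ^ θ) (2 * (q ^ 3 * CP)) ((q ^ 3) ^ 2) ((gdiam G : ℝ) ^ θ)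
    (Real.logb q (2 ^ θ)) hq (by positivity) (by positivity) (by positivity)
    (Real.logb_pos hq hT1) (Real.rpow_logb hq0 hq.ne' (by positivity)).symm
  · intro m
    have := psi_eq h y m
    have := psi_nonneg h y m
    linarith
  · intro m
    have h1 := phi_drop h hl y m
    have h2 := En_nonneg h (fun z => knorm K pi m z y)
    linarith
  · intro m j
    have := nash h hG hq0 hCP hVD hPI ((gdiam G : ℝ) / 2 ^ j) (by positivity) (q ^ j)
      (by positivity) (fun x => vol_scale h hq0 hVD hD x j) (fun z => knorm K pi m z y)
      (fun z => knorm_nonneg h m z y) (knorm_mass h m y)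
    rw [Real.div_rpow hD'.le (by positivity), hpow] at this
    refine this.trans ?_
    have h1 := phi_drop h hl y m
    have : q ^ 3 * (CP * ((gdiam G : ℝ) ^ θ / (2 ^ θ) ^ j)) * En K pi (fun z => knorm K pi m z y) ≤
      q ^ 3 * (CP * ((gdiam G : ℝ) ^ θ / (2 ^ θ) ^ j)) *
        (2 * (phi K pi y m - phi K pi y (m + 1))) := by
      gcongr
    linarith
  · obtain ⟨i, hi1, hi2⟩ := exists_nat_pow_near (x := (gdiam G : ℝ)) (y := 2)
      (by exact_mod_cast hD) (by norm_num)
    refine ⟨i + 1, ?_, ?_⟩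
    · have hv := vol_scale h hq0 hVD hD y (i + 1)
      have hb : gball G y ((gdiam G : ℝ) / 2 ^ (i + 1)) = {y} := by
        ext z
        rw [mem_gball, mem_singleton, le_div_iff₀ (by positivity)]
        constructor
        · intro hz
          by_contra hne
          have h1 : 0 < G.dist y z := hG.pos_dist_of_ne (fun h => hne h.symm)
          have h2 : (1 : ℝ) ≤ G.dist y z := by exact_mod_cast h1
          have h3 : (0 : ℝ) < 2 ^ (i + 1) := by positivity
          nlinarith
        · rintro rfl; simp
      rw [vol, hb, sum_singleton] at hv
      have : phi K pi y 0 = 1 / pi y := by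
        unfold phi
        rw [knorm_ip h]
        simp [knorm, matpow]
      rw [this, div_le_iff₀ (h.pos y)]
      exact hv
    · rw [pow_succ, mul_comm, ← hpow]
      gcongr

theorem main_pos {θ CP q : ℝ} (hθ : 0 < θ) (hCP : 0 < CP) (hq : 1 < q) (c0 : ℝ) (hc0 : 0 < c0) :
    ∃ C > (0 : ℝ), ∀ (W : Type) [Fintype W] [DecidableEq W] (G : SimpleGraph W)
      (K : W → W → ℝ) (pi : W → ℝ), G.Connected → RevK K pi → Lazy K → CondVD G pi q →
      CondPI G K pi θ CP → 0 < gdiam G → ∀ n : ℕ, c0 * (gdiam G : ℝ) ^ θ ≤ (n : ℝ) →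
      ∀ x y : W, |knorm K pi n x y - 1| ≤
        C * Real.exp (-(1 / (8 * CP)) * (n : ℝ) / (gdiam G : ℝ) ^ θ) := by
  set β := Real.logb q (2 ^ θ) with hβ
  set κ := min (β * ((2 * (q ^ 3) ^ 2 * q) ^ (-β) / (2 * (2 * (q ^ 3 * CP))))) (1 / 2 ^ θ) with hκ
  have hq0 : 0 < q := by linarith
  have hβ0 : 0 < β := Real.logb_pos hq (Real.one_lt_rpow (by norm_num) hθ)
  have hκ0 : 0 < κ := by
    apply lt_min <;> positivity
  set M := max (2 * (q ^ 3) ^ 2) ((κ * c0 / 4) ^ (-β⁻¹)) with hM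
  have hM0 : 0 < M := lt_max_of_lt_left (by positivity)
  refine ⟨M * Real.exp (1 / (2 * CP)), by positivity, ?_⟩
  intro W _ _ G K pi hG h hl hVD hPI hD n hn x y
  have hD1 : (1 : ℝ) ≤ gdiam G := by exact_mod_cast hD
  set L := (gdiam G : ℝ) ^ θ with hL
  have hL1 : 1 ≤ L := Real.one_le_rpow hD1 hθ.le
  have hL0 : 0 < L := by linarith
  have hphi : ∀ z : W, phi K pi z (n / 4) ≤ M := by
    intro z
    have hpos : 0 < phi K pi z (n / 4) := by
      have := psi_eq h z (n / 4)
      have := psi_nonneg h z (n / 4)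
      linarith
    rcases phi_bound h hl hG hq hθ hCP hVD hPI hD z (n / 4) with hb | hb
    · exact hb.trans (le_max_left _ _)
    · refine le_trans ?_ (le_max_right _ _)
      rw [← hβ, ← hκ, ← hL] at hb
      have h4 : (n : ℝ) ≤ 4 * (((n / 4 : ℕ) : ℝ) + 1) := by
        have : n ≤ 4 * (n / 4 + 1) := by omega
        exact_mod_cast this
      have h5 : κ * c0 / 4 ≤ phi K pi z (n / 4) ^ (-β) := by
        refine le_trans ?_ hb
        rw [le_div_iff₀ hL0]
        nlinarith
      have h6 := Real.rpow_le_rpow_of_nonpos (z := -β⁻¹) (by positivity) h5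
        (by have := inv_pos.mpr hβ0; linarith)
      rwa [← Real.rpow_mul hpos.le, neg_mul_neg, mul_inv_cancel₀ hβ0.ne', Real.rpow_one] at h6
  set g := 1 / (2 * CP * L) with hg
  have hg0 : 0 < g := by positivity
  set R := M * Real.exp (-((n / 4 - 1) * g)) with hR
  have hpsi : ∀ (z : W) (k : ℕ), n ≤ 4 * (k + 1) → psi K pi z (n / 4 + k) ≤ R := by
    intro z k hk
    have hk' : (n : ℝ) ≤ 4 * (k + 1) := by exact_mod_cast hk
    refine (gap h hl hCP hPI hD z (n / 4) k).trans ?_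
    rw [← hL, ← hg, hR, mul_comm]
    have := psi_eq h z (n / 4)
    have := hphi z
    have := psi_nonneg h z (n / 4)
    gcongr
    · linarith
    · linarith
  have hR0 : 0 ≤ R := by positivity
  have hfin : (knorm K pi n x y - 1) ^ 2 ≤ R ^ 2 := by
    have := final_cs h x y (n / 4 + (n / 2 - n / 4)) (n / 4 + (n - n / 2 - n / 4))
    rw [show n / 4 + (n / 2 - n / 4) + (n / 4 + (n - n / 2 - n / 4)) = n by omega] at this
    refine this.trans ?_
    rw [sq]
    exact mul_le_mul (hpsi x _ (by omega)) (hpsi y _ (by omega)) (psi_nonneg h _ _) hR0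
  refine (abs_le_of_sq_le_sq hfin hR0).trans ?_
  rw [hR, mul_assoc, ← Real.exp_add]
  gcongr
  have e : g * (2 * CP * L) = 1 := by rw [hg]; field_simp
  have h1 : g ≤ 1 / (2 * CP) := by
    rw [hg]
    apply one_div_le_one_div_of_le (by positivity)
    nlinarith
  have h2 : -(1 / (8 * CP)) * (n : ℝ) / L = -(n / 4 * g) := by
    rw [hg]; field_simp; ring
  rw [h2]; linarith

theorem diam_zero {K : W → W → ℝ} {pi : W → ℝ} (h : RevK K pi) {G : SimpleGraph W}
    (hG : G.Connected) (hD : gdiam G = 0) (n : ℕ) (x y : W) : knorm K pi n x y = 1 := by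
  have hs : ∀ a b : W, a = b := by
    intro a b
    have := dist_le_gdiam G a b
    rw [hD] at this
    exact (hG.dist_eq_zero_iff).1 (by omega)
  have hu : (univ : Finset W) = {x} := by ext z; simp [hs z x]
  have hm := knorm_mass h n y
  have ht := h.tot
  unfold ip at hm
  rw [hu, sum_singleton] at hm ht
  rw [ht] at hm; linarith

end Aux

/-- For a lazy Harnack graph, `|k^n(x,y) − 1| ≤ C₁ exp(−C₂ n / D^θ)`
for all `n ≥ c₀ D^θ`, with `C₂` depending only on `θ` and the Harnack constants, and
`C₁` depending additionally on `c₀`. -/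
theorem stmt5 (θ p0 CD CP Ccs1 Ccs2 ε : ℝ) (hθ : 2 ≤ θ) :
    ∃ C2 > (0 : ℝ), ∀ c0 > (0 : ℝ), ∃ C1 > (0 : ℝ),
      ∀ (V : Type) [Fintype V] [DecidableEq V],
        ∀ (G : SimpleGraph V) (K : V → V → ℝ) (pi : V → ℝ),
          IsMarkovKernel G K pi → Harnack G K pi θ p0 CD CP Ccs1 Ccs2 ε → Lazy K →
          ∀ n : ℕ, c0 * (gdiam G : ℝ) ^ θ ≤ (n : ℝ) → ∀ x y : V,
            |knorm K pi n x y - 1| ≤ C1 * Real.exp (-C2 * (n : ℝ) / (gdiam G : ℝ) ^ θ) := by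
  by_cases hc : 0 < CP
  swap
  · refine ⟨1, one_pos, fun c0 _ => ⟨1, one_pos, ?_⟩⟩
    intro V _ _ G K pi _ hH
    exact absurd hH.2.2.1 hc
  refine ⟨1 / (8 * CP), by positivity, fun c0 hc0 => ?_⟩
  obtain ⟨C, hC, hmain⟩ := main_pos (θ := θ) (CP := CP) (q := max CD 2) (by linarith) hc
    (lt_of_lt_of_le (by norm_num) (le_max_right _ _)) c0 hc0
  refine ⟨C, hC, ?_⟩
  intro V _ _ G K pi hM hH hl n hn x y
  obtain ⟨hG, h1, h2, h3, h4, h5, -⟩ := hM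
  obtain ⟨-, -, -, -, -, -, -, hVD, hPI, -⟩ := hH
  have h : RevK K pi := ⟨h1, h2, h3, h4, h5⟩
  rcases Nat.eq_zero_or_pos (gdiam G) with hD | hD
  · rw [diam_zero h hG hD]
    simp only [sub_self, abs_zero]
    positivity
  · refine hmain V G K pi hG h hl ?_ hPI hD n hn x y
    intro z r hr
    refine (hVD z r hr).trans ?_
    exact mul_le_mul_of_nonneg_right (le_max_left _ _) (vol_pos h G z r hr.le).le
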